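/- Suppose C, K, B, and all N_j are analytic at ς_1,…,ς_κ ∈ ℂ and that K(ς_i) and K̂(ς_i) = Wᴴ K(ς_i) V are invertible for all i = 1,…,κ. Let c ∈ ℂ^p and let ν_1,…,ν_κ be nonnegative integers. Define W_{1,i} = (∂_{s^i}(cᴴ C K^{-1})(ς_κ))ᴴ ∈ ℂ^{n×1} for i = 0,…,ν_κ, and for 2 ≤ i ≤ κ, W_{i,j} = (∂_{s^j}((I_m ⊗ W_{i-1,ν_{κ-i+2}})ᴴ Ñ K^{-1})(ς_{κ-i+1}))ᴴ ∈ ℂ^{n×m^{i-1}} for j = 0,…,ν_{κ-i+1}. If the columns of all W_{i,j} lie in the column space of W, then for every 1 ≤ η ≤ κ and every i = 0,…,ν_{κ-η+1} the blockwise tangential Hermite interpolation conditions cᴴ ∂_{s_1^{i} s_2^{ν_{κ-η+2}} ⋯ s_η^{ν_κ}} G_η(ς_{κ-η+1},…,ς_κ) = cᴴ ∂_{s_1^{i} s_2^{ν_{κ-η+2}} ⋯ s_η^{ν_κ}} Ĝ_η(ς_{κ-η+1},…,ς_κ) hold. -/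

import Mathlib

open Matrix
open scoped Kronecker

namespace StructBilin

/-- Scaled sum of the bilinear terms: `𝔑(s, d) = ∑ i, d i • N i s`. -/
noncomputable def Nsum {n m : ℕ} (N : Fin m → ℂ → Matrix (Fin n) (Fin n) ℂ) (s : ℂ)
    (d : Fin m → ℂ) : Matrix (Fin n) (Fin n) ℂ :=
  ∑ i, d i • N i s

/-- Middle factor of the modified transfer function
`𝔾_{q+1}(σ 0, …, σ q | d 0, …, d (q-1)) = C (σ q) * gAux K B N σ d q`. -/
noncomputable def gAux {n m : ℕ} (K : ℂ → Matrix (Fin n) (Fin n) ℂ)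
    (B : ℂ → Matrix (Fin n) (Fin m) ℂ) (N : Fin m → ℂ → Matrix (Fin n) (Fin n) ℂ)
    (σ : ℕ → ℂ) (d : ℕ → Fin m → ℂ) : ℕ → Matrix (Fin n) (Fin m) ℂ
  | 0 => (K (σ 0))⁻¹ * B (σ 0)
  | j + 1 => (K (σ (j + 1)))⁻¹ * Nsum N (σ j) (d j) * gAux K B N σ d j

/-- The modified (scaled and summed) transfer function
`𝔾_{q+1}(σ 0, …, σ q | d 0, …, d (q-1))` (the level is `q + 1`, indices are 0-based). -/
noncomputable def Gmod {n m p : ℕ} (C : ℂ → Matrix (Fin p) (Fin n) ℂ)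
    (K : ℂ → Matrix (Fin n) (Fin n) ℂ) (B : ℂ → Matrix (Fin n) (Fin m) ℂ)
    (N : Fin m → ℂ → Matrix (Fin n) (Fin n) ℂ) (σ : ℕ → ℂ) (d : ℕ → Fin m → ℂ)
    (q : ℕ) : Matrix (Fin p) (Fin m) ℂ :=
  C (σ q) * gAux K B N σ d q

/-- Right tangential interpolation vectors:
`v 0 = K(σ 0)⁻¹ B(σ 0) b`, `v (j+1) = K(σ (j+1))⁻¹ 𝔑(σ j, d j) v j`. -/
noncomputable def vtan {n m : ℕ} (K : ℂ → Matrix (Fin n) (Fin n) ℂ)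
    (B : ℂ → Matrix (Fin n) (Fin m) ℂ) (N : Fin m → ℂ → Matrix (Fin n) (Fin n) ℂ)
    (σ : ℕ → ℂ) (d : ℕ → Fin m → ℂ) (b : Fin m → ℂ) : ℕ → Fin n → ℂ
  | 0 => (K (σ 0))⁻¹ *ᵥ (B (σ 0) *ᵥ b)
  | j + 1 => (K (σ (j + 1)))⁻¹ *ᵥ (Nsum N (σ j) (d j) *ᵥ vtan K B N σ d b j)

/-- Left tangential interpolation vectors (with reversed point sequence `τ` and
scaling sequence `e`):
`w 0 = K(τ 0)^{-ᴴ} C(τ 0)ᴴ c`, `w (t+1) = K(τ (t+1))^{-ᴴ} 𝔑(τ (t+1), e t)ᴴ w t`. -/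
noncomputable def wtan {n m p : ℕ} (C : ℂ → Matrix (Fin p) (Fin n) ℂ)
    (K : ℂ → Matrix (Fin n) (Fin n) ℂ) (N : Fin m → ℂ → Matrix (Fin n) (Fin n) ℂ)
    (τ : ℕ → ℂ) (e : ℕ → Fin m → ℂ) (c : Fin p → ℂ) : ℕ → Fin n → ℂ
  | 0 => ((K (τ 0))⁻¹)ᴴ *ᵥ ((C (τ 0))ᴴ *ᵥ c)
  | t + 1 => ((K (τ (t + 1)))⁻¹)ᴴ *ᵥ ((Nsum N (τ (t + 1)) (e t))ᴴ *ᵥ wtan C K N τ e c t)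

/-- Entrywise `t`-th complex derivative of a matrix-valued function. -/
noncomputable def mDeriv {α β : Type*} (t : ℕ) (f : ℂ → Matrix α β ℂ) (z : ℂ) :
    Matrix α β ℂ :=
  Matrix.of fun i j => iteratedDeriv t (fun w => f w i j) z

/-- Entrywise `t`-th complex derivative of a vector-valued function. -/
noncomputable def vDeriv {α : Type*} (t : ℕ) (f : ℂ → α → ℂ) (z : ℂ) : α → ℂ :=
  fun i => iteratedDeriv t (fun w => f w i) z

/-- Partial derivative in the `i`-th coordinate of a function of countably many
complex variables. -/
noncomputable def pD (i : ℕ) (f : (ℕ → ℂ) → ℂ) (s : ℕ → ℂ) : ℂ :=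
  deriv (fun z => f (Function.update s i z)) (s i)

/-- Mixed partial derivative `∂_{s_1^{ord 0} ⋯ s_t^{ord (t-1)}}` of a function of the
first `t` coordinates. -/
noncomputable def mixedD (ord : ℕ → ℕ) : ℕ → ((ℕ → ℂ) → ℂ) → (ℕ → ℂ) → ℂ
  | 0, f => f
  | t + 1, f => mixedD ord t ((pD t)^[ord t] f)

/-- The Hermite chain
`hChain t = ∂^{ℓ (t)}(𝔑(·, d t) K⁻¹)(σ t) ⋯ ∂^{ℓ 0}(𝔑(·, d 0) K⁻¹ B)(σ 0)`. -/
noncomputable def hChain {n m : ℕ} (K : ℂ → Matrix (Fin n) (Fin n) ℂ)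
    (B : ℂ → Matrix (Fin n) (Fin m) ℂ) (N : Fin m → ℂ → Matrix (Fin n) (Fin n) ℂ)
    (σ : ℕ → ℂ) (d : ℕ → Fin m → ℂ) (ℓ : ℕ → ℕ) : ℕ → Matrix (Fin n) (Fin m) ℂ
  | 0 => mDeriv (ℓ 0) (fun z => Nsum N z (d 0) * ((K z)⁻¹ * B z)) (σ 0)
  | t + 1 =>
      mDeriv (ℓ (t + 1)) (fun z => Nsum N z (d (t + 1)) * (K z)⁻¹) (σ (t + 1)) *
        hChain K B N σ d ℓ t

/-- Right tangential Hermite interpolation vectors. -/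
noncomputable def vHerm {n m : ℕ} (K : ℂ → Matrix (Fin n) (Fin n) ℂ)
    (B : ℂ → Matrix (Fin n) (Fin m) ℂ) (N : Fin m → ℂ → Matrix (Fin n) (Fin n) ℂ)
    (σ : ℕ → ℂ) (d : ℕ → Fin m → ℂ) (ℓ : ℕ → ℕ) (b : Fin m → ℂ) : ℕ → ℕ → Fin n → ℂ
  | 0, j => mDeriv j (fun z => (K z)⁻¹ * B z) (σ 0) *ᵥ b
  | t + 1, j => (mDeriv j (fun z => (K z)⁻¹) (σ (t + 1)) * hChain K B N σ d ℓ t) *ᵥ b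

/-- Left tangential Hermite interpolation vectors (with reversed sequences). -/
noncomputable def wHerm {n m p : ℕ} (C : ℂ → Matrix (Fin p) (Fin n) ℂ)
    (K : ℂ → Matrix (Fin n) (Fin n) ℂ) (N : Fin m → ℂ → Matrix (Fin n) (Fin n) ℂ)
    (τ : ℕ → ℂ) (e : ℕ → Fin m → ℂ) (eν : ℕ → ℕ) (c : Fin p → ℂ) : ℕ → ℕ → Fin n → ℂ
  | 0, i => star (vDeriv i (fun z => Matrix.vecMul (star c) (C z * (K z)⁻¹)) (τ 0))
  | t + 1, j =>
      star (vDeriv j (fun z =>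
        Matrix.vecMul (star (wHerm C K N τ e eν c t (eν t))) (Nsum N z (e t) * (K z)⁻¹))
        (τ (t + 1)))

/-- Column index type of the `j+1`-st subsystem transfer function (`m^(j+1)` indices). -/
def colT (m : ℕ) : ℕ → Type
  | 0 => Fin m
  | j + 1 => Fin m × colT m j

def colTFintype (m : ℕ) : ∀ j, Fintype (colT m j)
  | 0 => inferInstanceAs (Fintype (Fin m))
  | j + 1 => letI := colTFintype m j; inferInstanceAs (Fintype (Fin m × colT m j))

attribute [instance] colTFintype

/-- Block index type (`m^j` indices). -/
def outT (m : ℕ) : ℕ → Type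
  | 0 => Fin 1
  | j + 1 => Fin m × outT m j

def outTFintype (m : ℕ) : ∀ j, Fintype (outT m j)
  | 0 => inferInstanceAs (Fintype (Fin 1))
  | j + 1 => letI := outTFintype m j; inferInstanceAs (Fintype (Fin m × outT m j))

attribute [instance] outTFintype

/-- The horizontal concatenation `N(s) = [N_1(s) ⋯ N_m(s)]`. -/
noncomputable def Nbig {n m : ℕ} (N : Fin m → ℂ → Matrix (Fin n) (Fin n) ℂ) (s : ℂ) :
    Matrix (Fin n) (Fin m × Fin n) ℂ :=
  Matrix.of fun i q => N q.1 s i q.2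

/-- The vertical concatenation `Ñ(s)` of `N_1(s), …, N_m(s)`. -/
noncomputable def Ntil {n m : ℕ} (N : Fin m → ℂ → Matrix (Fin n) (Fin n) ℂ) (s : ℂ) :
    Matrix (Fin m × Fin n) (Fin n) ℂ :=
  Matrix.of fun q i => N q.1 s q.2 i

/-- State part of the `j+1`-st subsystem transfer function:
`Z 0 = K(σ 0)⁻¹ B(σ 0)`, `Z (j+1) = K(σ (j+1))⁻¹ N(σ j) (I_m ⊗ Z j)`. -/
noncomputable def Zblk {n m : ℕ} (K : ℂ → Matrix (Fin n) (Fin n) ℂ)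
    (B : ℂ → Matrix (Fin n) (Fin m) ℂ) (N : Fin m → ℂ → Matrix (Fin n) (Fin n) ℂ)
    (σ : ℕ → ℂ) : (j : ℕ) → Matrix (Fin n) (colT m j) ℂ
  | 0 => (K (σ 0))⁻¹ * B (σ 0)
  | j + 1 =>
      (K (σ (j + 1)))⁻¹ * Nbig N (σ j) *
        ((1 : Matrix (Fin m) (Fin m) ℂ) ⊗ₖ Zblk K B N σ j)

/-- The `q+1`-st subsystem transfer function `G_{q+1}(σ 0, …, σ q)`. -/
noncomputable def Gblk {n m p : ℕ} (C : ℂ → Matrix (Fin p) (Fin n) ℂ)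
    (K : ℂ → Matrix (Fin n) (Fin n) ℂ) (B : ℂ → Matrix (Fin n) (Fin m) ℂ)
    (N : Fin m → ℂ → Matrix (Fin n) (Fin n) ℂ) (σ : ℕ → ℂ) (q : ℕ) :
    Matrix (Fin p) (colT m q) ℂ :=
  C (σ q) * Zblk K B N σ q

/-- The tangential direction matrix `I_{m^j} ⊗ b`. -/
noncomputable def tangMat {m : ℕ} (b : Fin m → ℂ) :
    (j : ℕ) → Matrix (colT m j) (outT m j) ℂ
  | 0 => Matrix.of fun i _ => b i
  | j + 1 => (1 : Matrix (Fin m) (Fin m) ℂ) ⊗ₖ tangMat b j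

/-- Blockwise right interpolation matrices:
`V 0 = K(σ 0)⁻¹ B(σ 0) b`, `V (j+1) = K(σ (j+1))⁻¹ N(σ j) (I_m ⊗ V j)`. -/
noncomputable def Vblk {n m : ℕ} (K : ℂ → Matrix (Fin n) (Fin n) ℂ)
    (B : ℂ → Matrix (Fin n) (Fin m) ℂ) (N : Fin m → ℂ → Matrix (Fin n) (Fin n) ℂ)
    (σ : ℕ → ℂ) (b : Fin m → ℂ) : (j : ℕ) → Matrix (Fin n) (outT m j) ℂ
  | 0 => Matrix.of fun i _ => ((K (σ 0))⁻¹ *ᵥ (B (σ 0) *ᵥ b)) i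
  | j + 1 =>
      (K (σ (j + 1)))⁻¹ * Nbig N (σ j) *
        ((1 : Matrix (Fin m) (Fin m) ℂ) ⊗ₖ Vblk K B N σ b j)

/-- Blockwise left interpolation matrices (with reversed point sequence `τ`):
`W 0 = K(τ 0)^{-ᴴ} C(τ 0)ᴴ c`, `W (t+1) = K(τ (t+1))^{-ᴴ} Ñ(τ (t+1))ᴴ (I_m ⊗ W t)`. -/
noncomputable def Wblk {n m p : ℕ} (C : ℂ → Matrix (Fin p) (Fin n) ℂ)
    (K : ℂ → Matrix (Fin n) (Fin n) ℂ) (N : Fin m → ℂ → Matrix (Fin n) (Fin n) ℂ)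
    (τ : ℕ → ℂ) (c : Fin p → ℂ) : (t : ℕ) → Matrix (Fin n) (outT m t) ℂ
  | 0 => Matrix.of fun i _ => (((K (τ 0))⁻¹)ᴴ *ᵥ ((C (τ 0))ᴴ *ᵥ c)) i
  | t + 1 =>
      ((K (τ (t + 1)))⁻¹)ᴴ * (Ntil N (τ (t + 1)))ᴴ *
        ((1 : Matrix (Fin m) (Fin m) ℂ) ⊗ₖ Wblk C K N τ c t)

/-- A vector as a one-column matrix. -/
noncomputable def bCol {m : ℕ} (b : Fin m → ℂ) : Matrix (Fin m) (Fin 1) ℂ :=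
  Matrix.of fun i _ => b i

/-- Blockwise Hermite chain. -/
noncomputable def hChainB {n m : ℕ} (K : ℂ → Matrix (Fin n) (Fin n) ℂ)
    (B : ℂ → Matrix (Fin n) (Fin m) ℂ) (N : Fin m → ℂ → Matrix (Fin n) (Fin n) ℂ)
    (σ : ℕ → ℂ) (ℓ : ℕ → ℕ) (b : Fin m → ℂ) :
    (t : ℕ) → Matrix (Fin n) (outT m (t + 1)) ℂ
  | 0 => mDeriv (ℓ 0)
      (fun z => Nbig N z * ((1 : Matrix (Fin m) (Fin m) ℂ) ⊗ₖ ((K z)⁻¹ * B z * bCol b)))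
      (σ 0)
  | t + 1 =>
      mDeriv (ℓ (t + 1))
        (fun z => Nbig N z * ((1 : Matrix (Fin m) (Fin m) ℂ) ⊗ₖ (K z)⁻¹)) (σ (t + 1)) *
        ((1 : Matrix (Fin m) (Fin m) ℂ) ⊗ₖ hChainB K B N σ ℓ b t)

/-- Blockwise right Hermite interpolation matrices. -/
noncomputable def vHermB {n m : ℕ} (K : ℂ → Matrix (Fin n) (Fin n) ℂ)
    (B : ℂ → Matrix (Fin n) (Fin m) ℂ) (N : Fin m → ℂ → Matrix (Fin n) (Fin n) ℂ)
    (σ : ℕ → ℂ) (ℓ : ℕ → ℕ) (b : Fin m → ℂ) : (t : ℕ) → ℕ → Matrix (Fin n) (outT m t) ℂ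
  | 0, j => mDeriv j (fun z => (K z)⁻¹ * B z * bCol b) (σ 0)
  | t + 1, j => mDeriv j (fun z => (K z)⁻¹) (σ (t + 1)) * hChainB K B N σ ℓ b t

/-- Blockwise left Hermite interpolation matrices (with reversed sequences). -/
noncomputable def wHermB {n m p : ℕ} (C : ℂ → Matrix (Fin p) (Fin n) ℂ)
    (K : ℂ → Matrix (Fin n) (Fin n) ℂ) (N : Fin m → ℂ → Matrix (Fin n) (Fin n) ℂ)
    (τ : ℕ → ℂ) (eν : ℕ → ℕ) (c : Fin p → ℂ) : (t : ℕ) → ℕ → Matrix (Fin n) (outT m t) ℂ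
  | 0, i => Matrix.of fun idx _ =>
      star (iteratedDeriv i (fun z => Matrix.vecMul (star c) (C z * (K z)⁻¹) idx) (τ 0))
  | t + 1, j => Matrix.of fun idx cc =>
      star (iteratedDeriv j (fun z =>
        (((1 : Matrix (Fin m) (Fin m) ℂ) ⊗ₖ wHermB C K N τ eν c t (eν t))ᴴ * Ntil N z *
          (K z)⁻¹) cc idx) (τ (t + 1)))

/-- The Kronecker product `d (j-1) ⊗ ⋯ ⊗ d 0 ⊗ I_m` of scaling vectors with the identity. -/
noncomputable def dKron {m : ℕ} (d : ℕ → Fin m → ℂ) :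
    (j : ℕ) → Matrix (colT m j) (Fin m) ℂ
  | 0 => (1 : Matrix (Fin m) (Fin m) ℂ)
  | j + 1 => Matrix.of fun (pq : Fin m × colT m j) cix => d j pq.1 * dKron d j pq.2 cix

/-- The innermost (input) coordinate of a column multi-index. -/
def innerIdx (m : ℕ) : (j : ℕ) → colT m j → Fin m
  | 0 => fun x => x
  | j + 1 => fun (pq : Fin m × colT m j) => innerIdx m j pq.2

/-- The chain `K(σ t)⁻¹ N_{J (t-1)}(σ (t-1)) ⋯ N_{J 0}(σ 0) K(σ 0)⁻¹ B(σ 0)`. -/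
noncomputable def eChain {n m : ℕ} (K : ℂ → Matrix (Fin n) (Fin n) ℂ)
    (B : ℂ → Matrix (Fin n) (Fin m) ℂ) (N : Fin m → ℂ → Matrix (Fin n) (Fin n) ℂ)
    (σ : ℕ → ℂ) (J : ℕ → Fin m) : ℕ → Matrix (Fin n) (Fin m) ℂ
  | 0 => (K (σ 0))⁻¹ * B (σ 0)
  | t + 1 => (K (σ (t + 1)))⁻¹ * N (J t) (σ t) * eChain K B N σ J t

section Derivatives

variable {α β γ : Type*}

theorem pD_iterate (k t : ℕ) (f : (ℕ → ℂ) → ℂ) (s : ℕ → ℂ) :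
    (pD t)^[k] f s = iteratedDeriv k (fun z => f (Function.update s t z)) (s t) := by
  induction k generalizing s with
  | zero => simp
  | succ k ih =>
    rw [Function.iterate_succ_apply', iteratedDeriv_succ]
    unfold pD at ih ⊢
    simp [ih]

/-- `mixedD ord t f s` only sees the values of `f` at points agreeing with `s` from `t` on. -/
theorem mixedD_congr (ord : ℕ → ℕ) (t : ℕ) {f g : (ℕ → ℂ) → ℂ} {s : ℕ → ℂ}
    (h : ∀ s', (∀ j, t ≤ j → s' j = s j) → f s' = g s') :
    mixedD ord t f s = mixedD ord t g s := by
  induction t generalizing f g with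
  | zero => exact h s fun _ _ => rfl
  | succ t ih =>
    refine ih fun s' hs' => ?_
    rw [pD_iterate, pD_iterate]
    congr 1
    funext z
    refine h _ fun j hj => ?_
    rw [Function.update_of_ne (by omega)]
    exact hs' j (by omega)

theorem vDeriv_vecMul [Fintype α] (k : ℕ) {f : ℂ → α → ℂ} {P : ℂ → Matrix α β ℂ} {z : ℂ}
    (hf : ∀ a, AnalyticAt ℂ (fun w => f w a) z)
    (hP : ∀ a b, AnalyticAt ℂ (fun w => P w a b) z) :
    vDeriv k (fun w => f w ᵥ* P w) z =
      ∑ i ∈ Finset.range (k + 1), (k.choose i : ℂ) • (vDeriv i f z ᵥ* mDeriv (k - i) P z) := by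
  funext b
  simp only [vDeriv, vecMul, dotProduct, mDeriv, Finset.sum_apply, Pi.smul_apply, smul_eq_mul,
    of_apply, Finset.mul_sum]
  rw [iteratedDeriv_fun_sum fun a _ => ((hf a).fun_mul (hP a b)).contDiffAt, Finset.sum_comm]
  refine Finset.sum_congr rfl fun a _ => ?_
  have := iteratedDeriv_mul (n := k) (hf a).contDiffAt (hP a b).contDiffAt
  exact this.trans (Finset.sum_congr rfl fun i _ => by ring)

theorem mul_mDeriv [Fintype β] (k : ℕ) (M : Matrix α β ℂ) {P : ℂ → Matrix β γ ℂ} {z : ℂ}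
    (hP : ∀ a b, AnalyticAt ℂ (fun w => P w a b) z) :
    M * mDeriv k P z = mDeriv k (fun w => M * P w) z := by
  ext a b
  simp only [mDeriv, mul_apply, of_apply]
  rw [iteratedDeriv_fun_sum fun i _ => (analyticAt_const.fun_mul (hP i b)).contDiffAt]
  simp [iteratedDeriv_const_mul_field]

theorem mDeriv_congr (k : ℕ) {f g : ℂ → Matrix α β ℂ} {z : ℂ}
    (h : ∀ᶠ w in nhds z, f w = g w) : mDeriv k f z = mDeriv k g z := by
  ext a b
  exact Filter.EventuallyEq.iteratedDeriv_eq k (h.mono fun w hw => by simp [hw])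

theorem vDeriv_congr (k : ℕ) {f g : ℂ → α → ℂ} {z : ℂ}
    (h : ∀ᶠ w in nhds z, f w = g w) : vDeriv k f z = vDeriv k g z := by
  ext a
  exact Filter.EventuallyEq.iteratedDeriv_eq k (h.mono fun w hw => by simp [hw])

/-- If the jet of `f` lies in the row space of `M` and `M * P = M`, then right multiplication by
`P` does not change the jet of `f`. -/
theorem vDeriv_vecMul_of_mul_eq [Fintype α] [DecidableEq α] [Fintype γ] (k : ℕ)
    {f : ℂ → α → ℂ} {P : ℂ → Matrix α α ℂ} {M : Matrix γ α ℂ} {z : ℂ}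
    (hf : ∀ a, AnalyticAt ℂ (fun w => f w a) z)
    (hP : ∀ a b, AnalyticAt ℂ (fun w => P w a b) z)
    (hMP : ∀ᶠ w in nhds z, M * P w = M)
    (hfM : ∀ j ≤ k, ∃ y, vDeriv j f z = y ᵥ* M) :
    vDeriv k (fun w => f w ᵥ* P w) z = vDeriv k f z := by
  have h1 : ∀ a b, AnalyticAt ℂ (fun _ : ℂ => (1 : Matrix α α ℂ) a b) z :=
    fun _ _ => analyticAt_const
  have h2 := vDeriv_vecMul k hf h1
  simp only [vecMul_one] at h2
  rw [vDeriv_vecMul k hf hP, h2]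
  refine Finset.sum_congr rfl fun i hi => ?_
  obtain ⟨y, hy⟩ := hfM i (by simp at hi; omega)
  rw [hy, vecMul_vecMul, vecMul_vecMul, mul_mDeriv _ _ hP, mul_mDeriv _ _ h1,
    mDeriv_congr _ (f := fun w => M * P w) (g := fun _ => M * (1 : Matrix α α ℂ))
      (hMP.mono fun w hw => by rw [hw, Matrix.mul_one])]

theorem vDeriv_sum_smul {ι : Type*} [Fintype ι] (k : ℕ) (x : ι → ℂ) {u : ι → ℂ → α → ℂ} {z : ℂ}
    (hu : ∀ l a, AnalyticAt ℂ (fun w => u l w a) z) :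
    vDeriv k (fun w => ∑ l, x l • u l w) z = ∑ l, x l • vDeriv k (u l) z := by
  funext a
  simp only [vDeriv, Finset.sum_apply, Pi.smul_apply, smul_eq_mul]
  rw [iteratedDeriv_fun_sum fun l _ => (analyticAt_const.fun_mul (hu l a)).contDiffAt]
  simp [iteratedDeriv_const_mul_field]

theorem analyticAt_sum_smul {ι : Type*} [Fintype ι] (x : ι → ℂ) {u : ι → ℂ → α → ℂ} {z : ℂ}
    (hu : ∀ l a, AnalyticAt ℂ (fun w => u l w a) z) (a : α) :
    AnalyticAt ℂ (fun w => (∑ l, x l • u l w) a) z := by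
  simp only [Finset.sum_apply, Pi.smul_apply, smul_eq_mul]
  exact Finset.analyticAt_fun_sum _ fun l _ => analyticAt_const.mul (hu l a)

theorem analyticAt_vecMul [Fintype α] {f : ℂ → α → ℂ} {P : ℂ → Matrix α β ℂ} {z : ℂ}
    (hf : ∀ a, AnalyticAt ℂ (fun w => f w a) z)
    (hP : ∀ a b, AnalyticAt ℂ (fun w => P w a b) z) (b : β) :
    AnalyticAt ℂ (fun w => (f w ᵥ* P w) b) z :=
  Finset.analyticAt_fun_sum _ fun a _ => (hf a).mul (hP a b)

theorem analyticAt_mul [Fintype β] {P : ℂ → Matrix α β ℂ} {Q : ℂ → Matrix β γ ℂ} {z : ℂ}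
    (hP : ∀ a b, AnalyticAt ℂ (fun w => P w a b) z)
    (hQ : ∀ a b, AnalyticAt ℂ (fun w => Q w a b) z) (a : α) (b : γ) :
    AnalyticAt ℂ (fun w => (P w * Q w) a b) z := by
  simp only [mul_apply]
  exact Finset.analyticAt_fun_sum _ fun i _ => (hP a i).mul (hQ i b)

theorem analyticAt_det [Fintype α] [DecidableEq α] {P : ℂ → Matrix α α ℂ} {z : ℂ}
    (hP : ∀ a b, AnalyticAt ℂ (fun w => P w a b) z) :
    AnalyticAt ℂ (fun w => (P w).det) z := by
  simp only [det_apply, Units.smul_def, zsmul_eq_mul]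
  exact Finset.analyticAt_fun_sum _ fun σ _ =>
    analyticAt_const.mul (Finset.analyticAt_fun_prod _ fun i _ => hP _ _)

theorem analyticAt_inv [Fintype α] [DecidableEq α] {P : ℂ → Matrix α α ℂ} {z : ℂ}
    (hP : ∀ a b, AnalyticAt ℂ (fun w => P w a b) z) (h : IsUnit (P z).det) (a b : α) :
    AnalyticAt ℂ (fun w => (P w)⁻¹ a b) z := by
  simp only [inv_def, Ring.inverse_eq_inv', Matrix.smul_apply, smul_eq_mul, adjugate_apply]
  refine ((analyticAt_det hP).inv h.ne_zero).mul (analyticAt_det fun i j => ?_)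
  by_cases hi : i = b
  · subst hi
    simpa using analyticAt_const
  · simpa [updateRow_ne hi] using hP i j

theorem eventually_isUnit_det [Fintype α] [DecidableEq α] {P : ℂ → Matrix α α ℂ} {z : ℂ}
    (hP : ∀ a b, AnalyticAt ℂ (fun w => P w a b) z) (h : IsUnit (P z).det) :
    ∀ᶠ w in nhds z, IsUnit (P w).det :=
  ((analyticAt_det hP).continuousAt.eventually_ne h.ne_zero).mono fun _ hw => hw.isUnit

end Derivatives

section Chain

variable {n m : ℕ}

/-- A column of the state part of a subsystem transfer function, without its leading resolvent;
`A` plays the role of the resolvent. -/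
noncomputable def colChain (A : ℂ → Matrix (Fin n) (Fin n) ℂ) (B : ℂ → Matrix (Fin n) (Fin m) ℂ)
    (N : Fin m → ℂ → Matrix (Fin n) (Fin n) ℂ) (s : ℕ → ℂ) : (q : ℕ) → colT m q → Fin n → ℂ
  | 0 => fun cc i => B (s 0) i cc
  | q + 1 => fun (cc : Fin m × colT m q) =>
      (N cc.1 (s q) * A (s q)) *ᵥ colChain A B N s q cc.2

theorem colChain_congr (A : ℂ → Matrix (Fin n) (Fin n) ℂ) (B : ℂ → Matrix (Fin n) (Fin m) ℂ)
    (N : Fin m → ℂ → Matrix (Fin n) (Fin n) ℂ) {s s' : ℕ → ℂ} (q : ℕ) (cc : colT m q)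
    (h : ∀ j ≤ q, s j = s' j) : colChain A B N s q cc = colChain A B N s' q cc := by
  induction q with
  | zero => simp only [colChain, h 0 le_rfl]
  | succ q ih =>
    simp only [colChain, h q (Nat.le_succ q)]
    rw [ih cc.2 fun j hj => h j (by omega)]

variable {A : ℂ → Matrix (Fin n) (Fin n) ℂ} {B : ℂ → Matrix (Fin n) (Fin m) ℂ}
  {N : Fin m → ℂ → Matrix (Fin n) (Fin n) ℂ} {σ : ℕ → ℂ} {ord : ℕ → ℕ}

theorem mixedD_colChain_zero (u : ℂ → Fin n → ℂ) (cc : colT m 0) :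
    mixedD ord 1 (fun s => u (s 0) ⬝ᵥ colChain A B N s 0 cc) σ =
      vDeriv (ord 0) (fun z => u z ᵥ* B z) (σ 0) cc := by
  change (pD 0)^[ord 0] _ σ = _
  rw [pD_iterate]
  simp only [Function.update_self]
  rfl

theorem mixedD_colChain_succ (q : ℕ) {u : ℂ → Fin n → ℂ}
    (hu : ∀ a, AnalyticAt ℂ (fun z => u z a) (σ (q + 1))) (cc : Fin m × colT m q) :
    mixedD ord (q + 2) (fun s => u (s (q + 1)) ⬝ᵥ colChain A B N s (q + 1) cc) σ =
      mixedD ord (q + 1) (fun s =>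
        (vDeriv (ord (q + 1)) u (σ (q + 1)) ᵥ* (N cc.1 (s q) * A (s q))) ⬝ᵥ
          colChain A B N s q cc.2) σ := by
  refine mixedD_congr ord (q + 1) fun s hs => ?_
  rw [pD_iterate, ← dotProduct_mulVec]
  change _ = _ ⬝ᵥ colChain A B N s (q + 1) cc
  have hc : ∀ z, colChain A B N (Function.update s (q + 1) z) (q + 1) cc =
      colChain A B N s (q + 1) cc := fun z => by
    simp only [colChain]
    rw [Function.update_of_ne (by omega), colChain_congr A B N (s' := s) q]
    intro j hj
    rw [Function.update_of_ne (by omega)]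
  simp only [hc, Function.update_self, dotProduct, vDeriv, hs (q + 1) le_rfl]
  rw [iteratedDeriv_fun_sum fun a _ => ((hu a).fun_mul analyticAt_const).contDiffAt]
  simp [iteratedDeriv_mul_const_field]

theorem sum_mul_mixedD_colChain {p : ℕ} (q : ℕ) (x : Fin p → ℂ) {u : Fin p → ℂ → Fin n → ℂ}
    (hu : ∀ l a, AnalyticAt ℂ (fun z => u l z a) (σ q))
    (hA : ∀ j < q, ∀ a b, AnalyticAt ℂ (fun z => A z a b) (σ j))
    (hB : ∀ a b, AnalyticAt ℂ (fun z => B z a b) (σ 0))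
    (hN : ∀ j < q, ∀ ι a b, AnalyticAt ℂ (fun z => N ι z a b) (σ j)) (cc : colT m q) :
    ∑ l, x l * mixedD ord (q + 1) (fun s => u l (s q) ⬝ᵥ colChain A B N s q cc) σ =
      mixedD ord (q + 1) (fun s => (∑ l, x l • u l (s q)) ⬝ᵥ colChain A B N s q cc) σ := by
  induction q generalizing u with
  | zero =>
    have key : ∀ b, ∑ l, x l * vDeriv (ord 0) (fun z => u l z ᵥ* B z) (σ 0) b =
        vDeriv (ord 0) (fun z => (∑ l, x l • u l z) ᵥ* B z) (σ 0) b := fun b => by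
      have h := vDeriv_sum_smul (ord 0) x fun l => analyticAt_vecMul (hu l) hB
      simp only [sum_vecMul, smul_vecMul, h, Finset.sum_apply, Pi.smul_apply, smul_eq_mul]
    refine (Finset.sum_congr rfl fun l _ => ?_).trans
      ((key cc).trans (mixedD_colChain_zero (fun z => ∑ l, x l • u l z) cc).symm)
    exact congrArg _ (mixedD_colChain_zero (u l) cc)
  | succ q ih =>
    have hNA := fun j hj => analyticAt_mul (hN j hj cc.1) (hA j hj)
    refine (Finset.sum_congr rfl fun l _ =>
      congrArg _ (mixedD_colChain_succ q (hu l) cc)).trans (Eq.trans ?_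
        (mixedD_colChain_succ q (u := fun z => ∑ l, x l • u l z)
          (analyticAt_sum_smul x hu) cc).symm)
    simp only [vDeriv_sum_smul _ x hu, sum_vecMul, smul_vecMul]
    exact ih
      (u := fun l z => vDeriv (ord (q + 1)) (u l) (σ (q + 1)) ᵥ* (N cc.1 z * A z))
      (fun l => analyticAt_vecMul (fun _ => analyticAt_const) (hNA q (by omega)))
      (fun j hj => hA j (by omega)) (fun j hj => hN j (by omega)) cc.2

end Chain

section Reduction

variable {n m p r : ℕ} {C : ℂ → Matrix (Fin p) (Fin n) ℂ} {K : ℂ → Matrix (Fin n) (Fin n) ℂ}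
  {B : ℂ → Matrix (Fin n) (Fin m) ℂ} {N : Fin m → ℂ → Matrix (Fin n) (Fin n) ℂ}

theorem Zblk_reduced (V W : Matrix (Fin n) (Fin r) ℂ) (s : ℕ → ℂ) (q : ℕ) (cc : colT m q) :
    (Zblk (fun s => Wᴴ * K s * V) (fun s => Wᴴ * B s) (fun ι s => Wᴴ * N ι s * V) s q).col cc =
      ((Wᴴ * K (s q) * V)⁻¹ * Wᴴ) *ᵥ
        colChain (fun z => V * (Wᴴ * K z * V)⁻¹ * Wᴴ) B N s q cc := by
  induction q with
  | zero =>
    funext i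
    simp only [Zblk, colChain, ← Matrix.mul_assoc]
    rfl
  | succ q ih =>
    obtain ⟨a, cc⟩ := cc
    simp only [colChain]
    funext i
    have h : ∀ X : Matrix (Fin r) (colT m q) ℂ, ∀ Y : Fin m → ℂ → Matrix (Fin r) (Fin r) ℂ,
        (Nbig Y (s q) * ((1 : Matrix (Fin m) (Fin m) ℂ) ⊗ₖ X)).col (a, cc) =
          Y a (s q) *ᵥ X.col cc := by
      intro X Y
      funext i
      simp [Nbig, col_apply, mul_apply, mulVec, dotProduct, Fintype.sum_prod_type,
        kroneckerMap_apply, one_apply, ite_mul, mul_ite, Finset.sum_ite_irrel]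
    have h2 : ∀ (X : Matrix (Fin r) (Fin r) ℂ) (Y : Matrix (Fin r) (Fin m × colT m q) ℂ) x,
        (X * Y).col x = X *ᵥ Y.col x := fun X Y x => rfl
    change ((_ * _ * _ : Matrix (Fin r) (Fin m × colT m q) ℂ).col (a, cc)) i = _
    rw [Matrix.mul_assoc, h2, h, ih]
    simp only [mulVec_mulVec, Matrix.mul_assoc]

theorem Gblk_reduced_apply (V W : Matrix (Fin n) (Fin r) ℂ) (s : ℕ → ℂ) (q : ℕ) (a : Fin p)
    (cc : colT m q) :
    Gblk (fun s => C s * V) (fun s => Wᴴ * K s * V) (fun s => Wᴴ * B s)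
        (fun ι s => Wᴴ * N ι s * V) s q a cc =
      (C (s q) * (V * (Wᴴ * K (s q) * V)⁻¹ * Wᴴ)) a ⬝ᵥ
        colChain (fun z => V * (Wᴴ * K z * V)⁻¹ * Wᴴ) B N s q cc := by
  change ((C (s q) * V) *ᵥ (Zblk _ _ _ s q).col cc) a = (_ *ᵥ _) a
  rw [Zblk_reduced, mulVec_mulVec]
  simp only [Matrix.mul_assoc]

theorem Gblk_apply (s : ℕ → ℂ) (q : ℕ) (a : Fin p) (cc : colT m q) :
    Gblk C K B N s q a cc =
      (C (s q) * (K (s q))⁻¹) a ⬝ᵥ colChain (fun z => (K z)⁻¹) B N s q cc := by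
  simpa using Gblk_reduced_apply (C := C) (K := K) (B := B) (N := N) (1 : Matrix (Fin n) (Fin n) ℂ) 1 s q a cc

theorem star_wHermB_succ (τ : ℕ → ℂ) (eν : ℕ → ℕ) (c : Fin p → ℂ) (t j : ℕ) (a : Fin m)
    (o : outT m t) :
    star (fun i => wHermB C K N τ eν c (t + 1) j i (a, o)) =
      vDeriv j (fun z => star (fun i => wHermB C K N τ eν c t (eν t) i o) ᵥ* (N a z * (K z)⁻¹))
        (τ (t + 1)) := by
  have h : ∀ (X : Matrix (Fin n) (outT m t) ℂ) (z : ℂ),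
      ((((1 : Matrix (Fin m) (Fin m) ℂ) ⊗ₖ X)ᴴ * Ntil N z) : Matrix (Fin m × outT m t) _ ℂ) (a, o) =
        star (fun i => X i o) ᵥ* N a z := by
    intro X z
    funext i
    simp [Ntil, mul_apply, vecMul, dotProduct, Fintype.sum_prod_type, conjTranspose_apply,
      kroneckerMap_apply, one_apply, ite_mul, Finset.sum_ite_irrel, apply_ite]
  funext i
  change star (star (iteratedDeriv j (fun z =>
    ((((1 : Matrix (Fin m) (Fin m) ℂ) ⊗ₖ wHermB C K N τ eν c t (eν t))ᴴ * Ntil N z * (K z)⁻¹ :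
      Matrix (Fin m × outT m t) (Fin n) ℂ) (a, o)) i) (τ (t + 1)))) = _
  refine (star_star _).trans (congrArg (fun f => iteratedDeriv j f (τ (t + 1))) ?_)
  funext z
  change _ = (_ ᵥ* (N a z * (K z)⁻¹)) i
  rw [← vecMul_vecMul, ← h]
  rfl

variable {A' P : ℂ → Matrix (Fin n) (Fin n) ℂ} {W : Matrix (Fin n) (Fin r) ℂ} {σ τ : ℕ → ℂ}
  {ord eν : ℕ → ℕ} {c : Fin p → ℂ}

/-- Two chains, with resolvents `K⁻¹` and `A' = K⁻¹ * P`, have the same mixed derivative when their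
left factors have the jet prescribed by the left Hermite interpolation vectors. -/
theorem mixedD_colChain_eq (q t : ℕ) {u u' : ℂ → Fin n → ℂ} (o : outT m t)
    (hσ : ∀ j ≤ q, σ j = τ (t + (q - j))) (hord : ∀ j ≤ q, 0 < j → ord j = eν (t + (q - j)))
    (hord0 : ord 0 ≤ eν (t + q))
    (hW : ∀ t' ≤ t + q, ∀ j ≤ eν t', ∀ o : outT m t',
      (fun i => wHermB C K N τ eν c t' j i o) ∈ Set.range W.mulVec)
    (hA : ∀ j ≤ q, ∀ a b, AnalyticAt ℂ (fun z => (K z)⁻¹ a b) (σ j))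
    (hA' : ∀ j ≤ q, ∀ a b, AnalyticAt ℂ (fun z => A' z a b) (σ j))
    (hP : ∀ j ≤ q, ∀ a b, AnalyticAt ℂ (fun z => P z a b) (σ j))
    (hB : ∀ a b, AnalyticAt ℂ (fun z => B z a b) (σ 0))
    (hN : ∀ j ≤ q, ∀ ι a b, AnalyticAt ℂ (fun z => N ι z a b) (σ j))
    (hWP : ∀ j ≤ q, ∀ᶠ z in nhds (σ j), Wᴴ * P z = Wᴴ)
    (hAP : ∀ j ≤ q, ∀ᶠ z in nhds (σ j), A' z = (K z)⁻¹ * P z)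
    (hu : ∀ a, AnalyticAt ℂ (fun z => u z a) (σ q))
    (hu' : ∀ᶠ z in nhds (σ q), u' z = u z ᵥ* P z)
    (hjet : ∀ j ≤ ord q, vDeriv j u (σ q) = star (fun i => wHermB C K N τ eν c t j i o))
    (cc : colT m q) :
    mixedD ord (q + 1) (fun s => u (s q) ⬝ᵥ colChain (fun z => (K z)⁻¹) B N s q cc) σ =
      mixedD ord (q + 1) (fun s => u' (s q) ⬝ᵥ colChain A' B N s q cc) σ := by
  have hordq : ord q ≤ eν t := by
    rcases Nat.eq_zero_or_pos q with rfl | hq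
    · exact hord0
    · simp [hord q le_rfl hq]
  have hjet' : ∀ j ≤ ord q, vDeriv j u' (σ q) = vDeriv j u (σ q) := by
    intro j hj
    rw [vDeriv_congr j hu']
    refine vDeriv_vecMul_of_mul_eq j hu (hP q le_rfl) (hWP q le_rfl) fun i hi => ?_
    obtain ⟨y, hy⟩ := hW t (by omega) i (by omega) o
    exact ⟨star y, by rw [hjet i (by omega), ← hy, star_mulVec]⟩
  have hu'a : ∀ a, AnalyticAt ℂ (fun z => u' z a) (σ q) := fun a =>
    (analyticAt_vecMul hu (hP q le_rfl) a).congr (hu'.mono fun z hz => by simp [hz])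
  match q with
  | 0 =>
    refine (mixedD_colChain_zero u cc).trans (Eq.trans ?_ (mixedD_colChain_zero u' cc).symm)
    rw [vDeriv_vecMul _ hu hB, vDeriv_vecMul _ hu'a hB, Finset.sum_congr rfl]
    intro i hi
    rw [hjet' i (by simp at hi; omega)]
  | q + 1 =>
    obtain ⟨a, cc⟩ := cc
    refine (mixedD_colChain_succ q hu (a, cc)).trans
      (Eq.trans ?_ (mixedD_colChain_succ q hu'a (a, cc)).symm)
    rw [hjet' _ le_rfl]
    have hq : ord (q + 1) = eν t := by simpa using hord (q + 1) le_rfl (by omega)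
    have e : ∀ j ≤ q, t + (q + 1 - j) = t + 1 + (q - j) := fun j hj => by omega
    have e0 : t + (q + 1) = t + 1 + q := by omega
    have hNA := analyticAt_mul (hN q (by omega) a) (hA q (by omega))
    have hau := analyticAt_vecMul
      (f := fun _ => vDeriv (ord (q + 1)) u (σ (q + 1))) (fun _ => analyticAt_const) hNA
    have hu2 : ∀ᶠ z in nhds (σ q), vDeriv (ord (q + 1)) u (σ (q + 1)) ᵥ* (N a z * A' z) =
        vDeriv (ord (q + 1)) u (σ (q + 1)) ᵥ* (N a z * (K z)⁻¹) ᵥ* P z :=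
      (hAP q (by omega)).mono fun z hz => by rw [hz, vecMul_vecMul, Matrix.mul_assoc]
    have hσq : σ q = τ (t + 1) := by simpa using hσ q (by omega)
    refine mixedD_colChain_eq q (t + 1) (u := fun z => vDeriv (ord (q + 1)) u (σ (q + 1)) ᵥ* (N a z * (K z)⁻¹))
      (u' := fun z => vDeriv (ord (q + 1)) u (σ (q + 1)) ᵥ* (N a z * A' z)) (a, o)
      (fun j hj => by rw [hσ j (by omega), e j hj])
      (fun j hj h0 => by rw [hord j (by omega) h0, e j hj]) (e0 ▸ hord0)
      (fun t' ht' => hW t' (by omega))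
      (fun j hj => hA j (by omega)) (fun j hj => hA' j (by omega)) (fun j hj => hP j (by omega))
      hB (fun j hj => hN j (by omega)) (fun j hj => hWP j (by omega)) (fun j hj => hAP j (by omega))
      hau hu2 (fun j hj => ?_) cc
    refine Eq.trans ?_ (star_wHermB_succ τ eν c t j a o).symm
    rw [hσq, hjet _ le_rfl, hq]

end Reduction

theorem stmt_12 {n m p r : ℕ} (hn : 0 < n) (hm : 0 < m) (hp : 0 < p) (hr : 0 < r)
    (C : ℂ → Matrix (Fin p) (Fin n) ℂ) (K : ℂ → Matrix (Fin n) (Fin n) ℂ)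
    (B : ℂ → Matrix (Fin n) (Fin m) ℂ) (N : Fin m → ℂ → Matrix (Fin n) (Fin n) ℂ)
    (V W : Matrix (Fin n) (Fin r) ℂ)
    (κ : ℕ) (hκ : 0 < κ) (ς : ℕ → ℂ) (ν : ℕ → ℕ) (c : Fin p → ℂ)
    (hCa : ∀ i < κ, ∀ a e, AnalyticAt ℂ (fun z => C z a e) (ς i))
    (hKa : ∀ i < κ, ∀ a e, AnalyticAt ℂ (fun z => K z a e) (ς i))
    (hBa : ∀ i < κ, ∀ a e, AnalyticAt ℂ (fun z => B z a e) (ς i))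
    (hNa : ∀ i < κ, ∀ ι a e, AnalyticAt ℂ (fun z => N ι z a e) (ς i))
    (hK : ∀ i < κ, IsUnit (K (ς i)).det)
    (hKr : ∀ i < κ, IsUnit (Wᴴ * K (ς i) * V).det)
    (hW : ∀ t < κ, ∀ j ≤ ν (κ - 1 - t), ∀ cix : outT m t,
      (fun i =>
        wHermB C K N (fun t => ς (κ - 1 - t)) (fun t => ν (κ - 1 - t)) c t j i cix) ∈
          Set.range W.mulVec) :
    ∀ η < κ, ∀ i ≤ ν (κ - 1 - η),
      Matrix.vecMul (star c)
          (Matrix.of fun a cc =>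
            mixedD (fun t => if t = 0 then i else ν (κ - 1 - η + t)) (η + 1)
              (fun s => Gblk C K B N s η a cc) (fun j => ς (κ - 1 - η + j))) =
        Matrix.vecMul (star c)
          (Matrix.of fun a cc =>
            mixedD (fun t => if t = 0 then i else ν (κ - 1 - η + t)) (η + 1)
              (fun s => Gblk (fun s => C s * V) (fun s => Wᴴ * K s * V) (fun s => Wᴴ * B s) (fun ι s => Wᴴ * N ι s * V) s η a cc)
              (fun j => ς (κ - 1 - η + j))) := by
  intro η hη i hi
  let P : ℂ → Matrix (Fin n) (Fin n) ℂ := fun z => K z * (V * (Wᴴ * K z * V)⁻¹ * Wᴴ)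
  have hσκ : ∀ j ≤ η, κ - 1 - η + j < κ := fun j hj => by omega
  have hc : ∀ {α β : Type} (M : Matrix α β ℂ) (z : ℂ) a b, AnalyticAt ℂ (fun _ => M a b) z :=
    fun _ _ _ _ => analyticAt_const
  have hKra : ∀ j < κ, ∀ a b, AnalyticAt ℂ (fun z => (Wᴴ * K z * V) a b) (ς j) := fun j hj =>
    analyticAt_mul (analyticAt_mul (hc _ _) (hKa j hj)) (hc _ _)
  have hA : ∀ j < κ, ∀ a b, AnalyticAt ℂ (fun z => (K z)⁻¹ a b) (ς j) := fun j hj =>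
    analyticAt_inv (hKa j hj) (hK j hj)
  have hA' : ∀ j < κ, ∀ a b,
      AnalyticAt ℂ (fun z => (V * (Wᴴ * K z * V)⁻¹ * Wᴴ) a b) (ς j) := fun j hj =>
    analyticAt_mul (analyticAt_mul (hc _ _) (analyticAt_inv (hKra j hj) (hKr j hj))) (hc _ _)
  have hP : ∀ j < κ, ∀ a b, AnalyticAt ℂ (fun z => P z a b) (ς j) := fun j hj =>
    analyticAt_mul (hKa j hj) (hA' j hj)
  have hWP : ∀ j < κ, ∀ᶠ z in nhds (ς j), Wᴴ * P z = Wᴴ := fun j hj =>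
    (eventually_isUnit_det (hKra j hj) (hKr j hj)).mono fun z hz => by
      have h := Matrix.mul_nonsing_inv _ hz
      calc Wᴴ * P z = (Wᴴ * K z * V) * (Wᴴ * K z * V)⁻¹ * Wᴴ := by simp only [P, Matrix.mul_assoc]
        _ = Wᴴ := by rw [h, Matrix.one_mul]
  have hAP : ∀ j < κ, ∀ᶠ z in nhds (ς j), V * (Wᴴ * K z * V)⁻¹ * Wᴴ = (K z)⁻¹ * P z :=
    fun j hj => (eventually_isUnit_det (hKa j hj) (hK j hj)).mono fun z hz => by
      simp only [P]
      rw [← Matrix.mul_assoc (K z)⁻¹, Matrix.nonsing_inv_mul _ hz, Matrix.one_mul]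
  have hCA := fun j hj => analyticAt_mul (hCa j hj) (hA j hj)
  have hCA' := fun j hj => analyticAt_mul (hCa j hj) (hA' j hj)
  have hη0 : κ - 1 - η + η = κ - 1 := by omega
  funext cc
  simp only [vecMul, dotProduct, of_apply, Gblk_reduced_apply]
  simp only [Gblk_apply]
  refine (sum_mul_mixedD_colChain (σ := fun j => ς (κ - 1 - η + j)) η (star c) (u := fun l z => (C z * (K z)⁻¹) l)
    (hCA _ (hσκ η le_rfl)) (fun j hj => hA _ (hσκ j hj.le)) (hBa _ (hσκ 0 (by omega)))
    (fun j hj => hNa _ (hσκ j hj.le)) cc).trans (Eq.trans ?_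
    (sum_mul_mixedD_colChain (σ := fun j => ς (κ - 1 - η + j)) η (star c)
      (u := fun l z => (C z * (V * (Wᴴ * K z * V)⁻¹ * Wᴴ)) l)
      (hCA' _ (hσκ η le_rfl)) (fun j hj => hA' _ (hσκ j hj.le)) (hBa _ (hσκ 0 (by omega)))
      (fun j hj => hNa _ (hσκ j hj.le)) cc).symm)
  have hv : ∀ M : Matrix (Fin p) (Fin n) ℂ, ∑ l, star c l • M l = star c ᵥ* M := fun M => by
    funext b
    simp [vecMul, dotProduct]
  simp only [hv]
  refine mixedD_colChain_eq (C := C) (P := P) (W := W) (τ := fun t => ς (κ - 1 - t))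
    (eν := fun t => ν (κ - 1 - t)) (c := c) η 0
    (u := fun z => star c ᵥ* (C z * (K z)⁻¹))
    (u' := fun z => star c ᵥ* (C z * (V * (Wᴴ * K z * V)⁻¹ * Wᴴ))) (0 : Fin 1)
    (fun j hj => congrArg ς (by omega)) (fun j hj h0 => ?_) (by simpa using hi)
    (fun t ht => hW t (by omega)) (fun j hj => hA _ (hσκ j hj)) (fun j hj => hA' _ (hσκ j hj))
    (fun j hj => hP _ (hσκ j hj)) (hBa _ (hσκ 0 (by omega))) (fun j hj => hNa _ (hσκ j hj))
    (fun j hj => hWP _ (hσκ j hj)) (fun j hj => hAP _ (hσκ j hj))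
    (analyticAt_vecMul (fun _ => analyticAt_const) (hCA _ (hσκ η le_rfl)))
    ((hAP _ (hσκ η le_rfl)).mono fun z hz => by
      rw [hz, vecMul_vecMul, Matrix.mul_assoc])
    (fun j _ => ?_) cc
  · simp only [h0.ne', if_false]
    exact congrArg ν (by omega)
  · rw [hη0]
    funext b
    exact (star_star _).symm

end StructBilin
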